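/- Let D ∈ ℤ^{r×t} and A ∈ ℤ^{s×t}, let E = (D; A), let G ∈ ℤ^{t×p} be a matrix whose columns are exactly the elements of 𝒢(A), and set g(E) := max{‖v‖_1 : v ∈ 𝒢(DG)} (with max over the empty set equal to 0). Then for every n ≥ 1 and every (g^1,…,g^n) ∈ 𝒢(E^{(n)}) there exist nonnegative integers n_1,…,n_n and, for each i ∈ [n], vectors h^{i,1},…,h^{i,n_i} ∈ 𝒢(A) with h^{i,k} ⊑ g^i, such that g^i = Σ_{k=1}^{n_i} h^{i,k} for every i ∈ [n] and Σ_{i=1}^n n_i ≤ g(E). -/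

import Mathlib

/-- Two integer vectors are sign-compatible if they lie in the same orthant. -/
def SignCompat {ι : Type*} (x y : ι → ℤ) : Prop := ∀ i, 0 ≤ x i * y i

/-- The conformal order: `y ⊑ x` iff `y` and `x` are sign-compatible and
`|y i| ≤ |x i|` for every coordinate. -/
def Conforms {ι : Type*} (y x : ι → ℤ) : Prop :=
  SignCompat y x ∧ ∀ i, |y i| ≤ |x i|

/-- The Graver basis of an integer matrix `A`: the set of `⊑`-minimal nonzero
elements of `ker_ℤ(A)`. -/
def GraverBasis {κ ι : Type*} [Fintype ι] (A : Matrix κ ι ℤ) : Set (ι → ℤ) :=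
  {g | g ≠ 0 ∧ A.mulVec g = 0 ∧
    ∀ h : ι → ℤ, h ≠ 0 → A.mulVec h = 0 → Conforms h g → h = g}

/-- The `n`-fold product `E^{(n)}` of the bimatrix `E = (D; A)`. -/
def nFold {r s t : ℕ} (n : ℕ) (D : Matrix (Fin r) (Fin t) ℤ)
    (A : Matrix (Fin s) (Fin t) ℤ) :
    Matrix (Fin r ⊕ (Fin n × Fin s)) (Fin n × Fin t) ℤ :=
  Matrix.of fun I q =>
    match I with
    | Sum.inl a => D a q.2
    | Sum.inr ia => if q.1 = ia.1 then A ia.2 q.2 else 0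

open Finset

variable {ι κ : Type*}

theorem conforms_iff {x y : ι → ℤ} :
    Conforms y x ↔ ∀ i, (0 ≤ y i ∧ y i ≤ x i) ∨ (x i ≤ y i ∧ y i ≤ 0) := by
  constructor
  · rintro ⟨hs, ha⟩ i
    have h1 := hs i
    have h2 := ha i
    rcases le_total 0 (x i) with hx | hx <;> rcases le_total 0 (y i) with hy | hy
    · rw [abs_of_nonneg hx, abs_of_nonneg hy] at h2
      exact Or.inl ⟨hy, h2⟩
    · rw [abs_of_nonneg hx, abs_of_nonpos hy] at h2
      rcases hy.eq_or_lt with h0 | h0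
      · exact Or.inl ⟨h0.ge, by omega⟩
      · have : x i = 0 := by nlinarith
        omega
    · rw [abs_of_nonpos hx, abs_of_nonneg hy] at h2
      rcases hy.eq_or_lt with h0 | h0
      · exact Or.inr ⟨by omega, h0.ge⟩
      · have : x i = 0 := by nlinarith
        omega
    · rw [abs_of_nonpos hx, abs_of_nonpos hy] at h2
      exact Or.inr ⟨by omega, hy⟩
  · intro h
    refine ⟨fun i => ?_, fun i => ?_⟩
    · rcases h i with ⟨h1, h2⟩ | ⟨h1, h2⟩
      · exact mul_nonneg h1 (h1.trans h2)
      · exact mul_nonneg_of_nonpos_of_nonpos h2 (h1.trans h2)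
    · rcases h i with ⟨h1, h2⟩ | ⟨h1, h2⟩
      · exact abs_le_abs_of_nonneg h1 h2
      · exact abs_le_abs_of_nonpos h2 h1

theorem Conforms.rfl {x : ι → ℤ} : Conforms x x :=
  conforms_iff.2 fun i => by omega

theorem Conforms.trans {x y z : ι → ℤ} (hxy : Conforms x y) (hyz : Conforms y z) :
    Conforms x z := by
  rw [conforms_iff] at *
  intro i
  have h1 := hxy i
  have h2 := hyz i
  omega

theorem Conforms.sub {x y : ι → ℤ} (h : Conforms y x) : Conforms (x - y) x := by
  rw [conforms_iff] at *
  intro i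
  have := h i
  simp only [Pi.sub_apply]
  omega

theorem Conforms.eq_zero {y : ι → ℤ} (h : Conforms y 0) : y = 0 := by
  rw [conforms_iff] at h
  funext i
  have := h i
  simp only [Pi.zero_apply] at *
  omega

theorem Conforms.sum_natAbs_lt [Fintype ι] {x y : ι → ℤ} (h : Conforms y x) (hne : y ≠ x) :
    ∑ i, (y i).natAbs < ∑ i, (x i).natAbs := by
  rw [conforms_iff] at h
  obtain ⟨j, hj⟩ := Function.ne_iff.1 hne
  refine sum_lt_sum (fun i _ => ?_) ⟨j, mem_univ j, ?_⟩
  · have := h i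
    omega
  · have := h j
    omega

/-- Graver bases of matrices with finitely many columns are finite. -/
theorem graverBasis_finite [Fintype ι] (A : Matrix κ ι ℤ) : (GraverBasis A).Finite := by
  let f : (ι → ℤ) → ι → ℕ × ℕ := fun v i => ((v i).toNat, (-v i).toNat)
  have hf : Function.Injective f := fun v w h => by
    funext i
    have := congrFun h i
    simp only [f, Prod.mk.injEq] at this
    omega
  have hle {v w : ι → ℤ} (h : f v ≤ f w) : Conforms v w := by
    refine conforms_iff.2 fun i => ?_
    have := h i
    simp only [f, Prod.mk_le_mk] at this
    omega
  have hanti : IsAntichain (· ≤ ·) (f '' GraverBasis A) := by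
    rintro _ ⟨v, hv, rfl⟩ _ ⟨w, hw, rfl⟩ hne h
    exact hne (congrArg f (hw.2.2 v hv.1 hv.2.1 (hle h)))
  exact Set.Finite.of_finite_image (hanti.finite_of_partiallyWellOrderedOn
    (Set.isPWO_of_wellQuasiOrderedLE _)) hf.injOn

theorem bddAbove_graverBasis_norm [Fintype ι] (A : Matrix κ ι ℤ) :
    BddAbove {M : ℕ | ∃ v ∈ GraverBasis A, M = ∑ k, (v k).natAbs} := by
  refine ((graverBasis_finite A).image fun v => ∑ k, (v k).natAbs).bddAbove.mono ?_
  rintro _ ⟨v, hv, rfl⟩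
  exact ⟨v, hv, rfl⟩

theorem exists_mem_graverBasis_conforms [Fintype ι] (A : Matrix κ ι ℤ) (z : ι → ℤ)
    (hz : z ≠ 0) (hA : A.mulVec z = 0) : ∃ g ∈ GraverBasis A, Conforms g z := by
  induction hN : ∑ i, (z i).natAbs using Nat.strong_induction_on generalizing z with
  | _ N ih =>
    by_cases hmem : z ∈ GraverBasis A
    · exact ⟨z, hmem, Conforms.rfl⟩
    · simp only [GraverBasis, Set.mem_ofPred_eq, not_and, not_forall] at hmem
      obtain ⟨w, hw, hAw, hwz, hne⟩ := hmem hz hA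
      obtain ⟨g, hg, hgw⟩ := ih _ (hN ▸ hwz.sum_natAbs_lt hne) w hw hAw rfl
      exact ⟨g, hg, hgw.trans hwz⟩

/-- Every integer kernel element is a conformal nonnegative combination of the Graver basis. -/
theorem exists_conformal_combination [Fintype ι] {π : Type*} [Fintype π] (A : Matrix κ ι ℤ)
    (G : Matrix ι π ℤ) (hall : ∀ g ∈ GraverBasis A, ∃ k, (fun j => G j k) = g)
    (z : ι → ℤ) (hA : A.mulVec z = 0) :
    ∃ c : π → ℕ, (∀ k, c k ≠ 0 → Conforms (fun j => G j k) z) ∧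
      G.mulVec (fun k => (c k : ℤ)) = z := by
  classical
  induction hN : ∑ i, (z i).natAbs using Nat.strong_induction_on generalizing z with
  | _ N ih =>
    by_cases hz : z = 0
    · refine ⟨0, by simp, ?_⟩
      subst hz
      exact G.mulVec_zero
    · obtain ⟨g, hg, hgz⟩ := exists_mem_graverBasis_conforms A z hz hA
      obtain ⟨k₀, hk₀⟩ := hall g hg
      obtain ⟨c, hc, hcz⟩ := ih _
        (hN ▸ hgz.sub.sum_natAbs_lt fun h => hg.1 (sub_eq_self.1 h)) (z - g)
        (by rw [Matrix.mulVec_sub, hA, hg.2.1, sub_zero]) rfl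
      refine ⟨c + Pi.single k₀ 1, fun k hk => ?_, ?_⟩
      · by_cases h : k = k₀
        · rwa [h, hk₀]
        · refine (hc k ?_).trans hgz.sub
          simpa [h] using hk
      · have : (fun k => (((c + Pi.single k₀ 1 : π → ℕ) k : ℕ) : ℤ)) =
            (fun k => (c k : ℤ)) + Pi.single k₀ 1 := by
          funext k
          by_cases h : k = k₀
          · subst h; simp
          · simp [h]
        rw [this, Matrix.mulVec_add, hcz, Matrix.mulVec_single_one, ← hk₀]
        exact sub_add_cancel z _

/-- Combinations of vectors in a common orthant are monotone in their coefficients. -/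
theorem conforms_mulVec_of_le {π : Type*} [Fintype π] {G : Matrix ι π ℤ} {z : ι → ℤ}
    {c d : π → ℕ} (hd : ∀ k, d k ≠ 0 → Conforms (fun j => G j k) z) (hcd : c ≤ d) :
    Conforms (G.mulVec fun k => (c k : ℤ)) (G.mulVec fun k => (d k : ℤ)) := by
  have hle k : (c k : ℤ) ≤ d k := by exact_mod_cast hcd k
  refine conforms_iff.2 fun j => ?_
  simp only [Matrix.mulVec, dotProduct]
  rcases le_total 0 (z j) with hz | hz
  · left
    have key k (hk : d k ≠ 0) : 0 ≤ G j k := by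
      have := conforms_iff.1 (hd k hk) j
      omega
    refine ⟨sum_nonneg fun k _ => ?_, sum_le_sum fun k _ => ?_⟩
    all_goals by_cases hk : d k = 0
    · have : c k = 0 := Nat.le_zero.1 (hk ▸ hcd k)
      simp [this]
    · exact mul_nonneg (key k hk) (Int.natCast_nonneg _)
    · have : c k = 0 := Nat.le_zero.1 (hk ▸ hcd k)
      simp [this, hk]
    · exact mul_le_mul_of_nonneg_left (hle k) (key k hk)
  · right
    have key k (hk : d k ≠ 0) : G j k ≤ 0 := by
      have := conforms_iff.1 (hd k hk) j
      omega
    refine ⟨sum_le_sum fun k _ => ?_, sum_nonpos fun k _ => ?_⟩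
    all_goals by_cases hk : d k = 0
    · have : c k = 0 := Nat.le_zero.1 (hk ▸ hcd k)
      simp [this, hk]
    · exact mul_le_mul_of_nonpos_left (hle k) (key k hk)
    · have : c k = 0 := Nat.le_zero.1 (hk ▸ hcd k)
      simp [this]
    · exact mul_nonpos_of_nonpos_of_nonneg (key k hk) (Int.natCast_nonneg _)

theorem eq_zero_of_mulVec_eq_zero {π : Type*} [Fintype π] {G : Matrix ι π ℤ} {z : ι → ℤ}
    {c : π → ℕ} (hG : ∀ k, (fun j => G j k) ≠ 0)
    (hc : ∀ k, c k ≠ 0 → Conforms (fun j => G j k) z)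
    (h0 : (G.mulVec fun k => (c k : ℤ)) = 0) : c = 0 := by
  classical
  funext k
  by_contra hk
  have hle : (Pi.single k 1 : π → ℕ) ≤ c := by
    intro l
    by_cases hl : l = k
    · subst hl
      simpa [Nat.one_le_iff_ne_zero] using hk
    · simp [hl]
  have h := conforms_mulVec_of_le hc hle
  have hs : (fun l => (((Pi.single k 1 : π → ℕ) l : ℕ) : ℤ)) = Pi.single k 1 := by
    funext l
    by_cases hl : l = k
    · subst hl; simp
    · simp [hl]
  rw [h0, hs, Matrix.mulVec_single_one] at h
  exact hG k h.eq_zero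

theorem eq_of_le_of_mulVec_eq {π : Type*} [Fintype π] {G : Matrix ι π ℤ} {z : ι → ℤ}
    {c d : π → ℕ} (hG : ∀ k, (fun j => G j k) ≠ 0)
    (hd : ∀ k, d k ≠ 0 → Conforms (fun j => G j k) z) (hcd : c ≤ d)
    (h : (G.mulVec fun k => (c k : ℤ)) = G.mulVec fun k => (d k : ℤ)) : c = d := by
  have hsub : (fun k => ((d k - c k : ℕ) : ℤ)) = (fun k => (d k : ℤ)) - fun k => (c k : ℤ) :=
    funext fun k => Nat.cast_sub (hcd k)
  have h0 : (fun k => d k - c k) = 0 := by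
    refine eq_zero_of_mulVec_eq_zero hG (fun k hk => hd k fun h => hk (by simp [h])) ?_
    rw [hsub, Matrix.mulVec_sub, h, sub_self]
  funext k
  exact (hcd k).antisymm (Nat.sub_eq_zero_iff_le.1 (congrFun h0 k))

theorem exists_le_sum_eq (s : Finset ι) (a : ι → ℕ) (m : ℕ) (h : m ≤ ∑ i ∈ s, a i) :
    ∃ b ≤ a, ∑ i ∈ s, b i = m := by
  classical
  induction s using Finset.induction_on generalizing m with
  | empty => exact ⟨0, fun i => Nat.zero_le _, by simp_all⟩
  | insert j s hj ih =>
    rw [sum_insert hj] at h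
    obtain ⟨b, hb, hbm⟩ := ih (m - min m (a j)) (by omega)
    refine ⟨Function.update b j (min m (a j)), fun i => ?_, ?_⟩
    · by_cases hi : i = j
      · subst hi; simp
      · simpa [hi] using hb i
    · rw [sum_insert hj, Function.update_self, sum_congr rfl
        (fun i hi => Function.update_of_ne (ne_of_mem_of_not_mem hi hj) _ _), hbm]
      omega

theorem nFold_mulVec_eq_zero_iff {r s t n : ℕ} (D : Matrix (Fin r) (Fin t) ℤ)
    (A : Matrix (Fin s) (Fin t) ℤ) (x : Fin n × Fin t → ℤ) :
    (nFold n D A).mulVec x = 0 ↔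
      D.mulVec (∑ i, fun j => x (i, j)) = 0 ∧ ∀ i, A.mulVec (fun j => x (i, j)) = 0 := by
  have hD a : (nFold n D A).mulVec x (Sum.inl a) = D.mulVec (∑ i, fun j => x (i, j)) a := by
    simp only [Matrix.mulVec, dotProduct, nFold, Matrix.of_apply, Fintype.sum_prod_type,
      Finset.sum_apply, mul_sum]
    exact sum_comm
  have hA i b : (nFold n D A).mulVec x (Sum.inr (i, b)) = A.mulVec (fun j => x (i, j)) b := by
    simp only [Matrix.mulVec, dotProduct, nFold, Matrix.of_apply, Fintype.sum_prod_type]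
    rw [sum_eq_single i]
    · simp
    · intro l _ hl
      simp [hl]
    · simp
  constructor
  · intro h
    exact ⟨funext fun a => (hD a).symm.trans (congrFun h _),
      fun i => funext fun b => (hA i b).symm.trans (congrFun h _)⟩
  · rintro ⟨h1, h2⟩
    funext I
    rcases I with a | ⟨i, b⟩
    · exact (hD a).trans (congrFun h1 a)
    · exact (hA i b).trans (congrFun (h2 i) b)

/-- The total multiplicities of a conformal decomposition of the bricks of an element of
`𝒢(E^{(n)})` form an element of `𝒢(DG)`. -/
theorem sum_coeff_mem_graverBasis {r s t p n : ℕ}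
    {D : Matrix (Fin r) (Fin t) ℤ} {A : Matrix (Fin s) (Fin t) ℤ}
    {G : Matrix (Fin t) (Fin p) ℤ} (hcols : ∀ k, (fun j => G j k) ∈ GraverBasis A)
    {g : Fin n × Fin t → ℤ} (hg : g ∈ GraverBasis (nFold n D A)) {c : Fin n → Fin p → ℕ}
    (hc : ∀ i k, c i k ≠ 0 → Conforms (fun j => G j k) (fun j => g (i, j)))
    (hcg : ∀ i, G.mulVec (fun k => (c i k : ℤ)) = fun j => g (i, j)) :
    (fun k => ((∑ i, c i k : ℕ) : ℤ)) ∈ GraverBasis (D * G) := by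
  have hsum (b : Fin n → Fin p → ℕ) : G.mulVec (fun k => ((∑ i, b i k : ℕ) : ℤ)) =
      ∑ i, G.mulVec (fun k => (b i k : ℤ)) := by
    rw [← Matrix.mulVec_sum]
    congr 1
    funext k
    simp
  have hAG (b : Fin p → ℤ) : A.mulVec (G.mulVec b) = 0 := by
    have : A * G = 0 := by
      ext a k
      exact congrFun (hcols k).2.1 a
    rw [Matrix.mulVec_mulVec, this, Matrix.zero_mulVec]
  have hG0 k : (fun j => G j k) ≠ 0 := (hcols k).1
  have hker := (nFold_mulVec_eq_zero_iff D A g).1 hg.2.1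
  refine ⟨fun h0 => hg.1 ?_, ?_, fun μ hμ0 hμ hμc => ?_⟩
  · funext ⟨i, j⟩
    have hci : (fun k => (c i k : ℤ)) = 0 := by
      funext k
      have := congrFun h0 k
      simp only [Pi.zero_apply, Nat.cast_eq_zero, sum_eq_zero_iff, mem_univ,
        true_implies] at this
      simp [this i]
    have := congrFun (hcg i) j
    rw [hci, Matrix.mulVec_zero] at this
    exact this.symm
  · rw [← Matrix.mulVec_mulVec, hsum, sum_congr rfl fun i _ => hcg i]
    exact hker.1
  · rw [conforms_iff] at hμc
    have hμ' k : μ k = ((μ k).toNat : ℤ) ∧ (μ k).toNat ≤ ∑ i, c i k := by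
      have := hμc k
      omega
    choose b hbc hb using fun k => exists_le_sum_eq univ (fun i => c i k) _ (hμ' k).2
    have hμb : μ = fun k => ((∑ i, b k i : ℕ) : ℤ) := by
      funext k
      rw [hb, ← (hμ' k).1]
    let h : Fin n × Fin t → ℤ := fun q => G.mulVec (fun k => (b k q.1 : ℤ)) q.2
    have hle i : (fun k => b k i) ≤ c i := fun k => hbc k i
    have hconf : Conforms h g := by
      have hi i := conforms_mulVec_of_le (hc i) (hle i)
      simp only [hcg, conforms_iff] at hi
      exact conforms_iff.2 fun q => hi q.1 q.2
    have hbz i (h0 : G.mulVec (fun k => (b k i : ℤ)) = 0) k : b k i = 0 := by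
      refine congrFun (eq_zero_of_mulVec_eq_zero (c := fun k => b k i) hG0
        (fun k hk => hc i k ?_) h0) k
      have := hbc k i
      simp only at this hk
      omega
    have hne : h ≠ 0 := by
      intro h0
      refine hμ0 ?_
      rw [hμb]
      funext k
      simp only [Pi.zero_apply, Nat.cast_eq_zero]
      exact sum_eq_zero fun i _ => hbz i (funext fun j => congrFun h0 (i, j)) k
    have heq : h = g := by
      have hDG : D.mulVec (∑ i, G.mulVec fun k => (b k i : ℤ)) = 0 := by
        rw [← hsum fun i k => b k i, ← hμb, Matrix.mulVec_mulVec, hμ]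
      have hker' : (nFold n D A).mulVec h = 0 :=
        (nFold_mulVec_eq_zero_iff D A h).2 ⟨hDG, fun i => hAG fun k => (b k i : ℤ)⟩
      exact hg.2.2 h hne hker' hconf
    have hbc' i : (fun k => b k i) = c i := by
      refine eq_of_le_of_mulVec_eq hG0 (hc i) (hle i) ((hcg i).trans ?_).symm
      exact funext fun j => (congrFun heq (i, j)).symm
    rw [hμb]
    simp only [← hbc']

/-- Every brick `g^i` of a Graver basis element of `E^{(n)}` decomposes as a
sum of `n_i` elements of `𝒢(A)` conforming to `g^i`, with
`Σ_i n_i ≤ g(E) := max{‖v‖₁ : v ∈ 𝒢(DG)}`, where the columns of `G` are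
exactly the elements of `𝒢(A)`. -/
theorem nfold_graver_brick_decomposition {r s t p n : ℕ} (hn : 1 ≤ n)
    (D : Matrix (Fin r) (Fin t) ℤ) (A : Matrix (Fin s) (Fin t) ℤ)
    (G : Matrix (Fin t) (Fin p) ℤ)
    (hcols : ∀ k : Fin p, (fun j => G j k) ∈ GraverBasis A)
    (hall : ∀ g ∈ GraverBasis A, ∃ k : Fin p, (fun j => G j k) = g)
    (hinj : Function.Injective (fun (k : Fin p) (j : Fin t) => G j k))
    (g : Fin n × Fin t → ℤ) (hg : g ∈ GraverBasis (nFold n D A)) :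
    ∃ ns : Fin n → ℕ, ∃ h : (i : Fin n) → Fin (ns i) → (Fin t → ℤ),
      (∀ i k, h i k ∈ GraverBasis A) ∧
      (∀ i k, Conforms (h i k) (fun j => g (i, j))) ∧
      (∀ i, (fun j => g (i, j)) = ∑ k, h i k) ∧
      ∑ i, ns i ≤ sSup {M : ℕ | ∃ v ∈ GraverBasis (D * G), M = ∑ k, (v k).natAbs} := by
  choose c hc hcg using fun i => exists_conformal_combination A G hall (fun j => g (i, j))
    (((nFold_mulVec_eq_zero_iff D A g).1 hg.2.1).2 i)
  let e i := (finSigmaFinEquiv (n := c i)).symm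
  refine ⟨fun i => ∑ k, c i k, fun i l j => G j (e i l).1, fun i l => hcols _,
    fun i l => hc i _ ?_, fun i => ?_, le_csSup (bddAbove_graverBasis_norm _)
      ⟨_, sum_coeff_mem_graverBasis hcols hg hc hcg, ?_⟩⟩
  · exact (Fin.pos (e i l).2).ne'
  · rw [(e i).sum_comp fun x j => G j x.1, Fintype.sum_sigma, ← hcg]
    funext j
    simp [Matrix.mulVec, dotProduct, mul_comm]
  · simp only [Int.natAbs_natCast]
    exact sum_comm
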